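/- arXiv:1306.2914 — 2 statements merged into one kernel-verified Lean document; each statement's English description precedes it below -/
import Mathlib

section
/- For every twice continuously differentiable function u : [-b,b] → ℂ, the function T u(x) := u(x) + ∫_{−x}^{x} K(x,t)·u(t) dt is twice continuously differentiable on [-b,b] and satisfies −(T u)''(x) + q(x)·(T u)(x) = −u''(x) − ∫_{−x}^{x} K(x,t)·u''(t) dt for all x ∈ [-b,b]; that is, (−d²/dx² + q)·T[u] = T[−u'']. -/
open Set MeasureTheory Filter

/-- Second partial derivative with respect to the first variable, within `[-b,b]`. -/
noncomputable def d2x (b : ℝ) (K : ℝ → ℝ → ℂ) (x t : ℝ) : ℂ :=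
  derivWithin (fun x' => derivWithin (fun x'' => K x'' t) (Set.Icc (-b) b) x') (Set.Icc (-b) b) x

/-- Second partial derivative with respect to the second variable, within `[-b,b]`. -/
noncomputable def d2t (b : ℝ) (K : ℝ → ℝ → ℂ) (x t : ℝ) : ℂ :=
  derivWithin (fun t' => derivWithin (fun t'' => K x t'') (Set.Icc (-b) b) t') (Set.Icc (-b) b) t

/-- `K` is a transmutation kernel for `(q, h)` on `[-b,b]`: it is twice continuously
differentiable, satisfies `∂²K/∂x² − q(x)K = ∂²K/∂t²` on `[-b,b]²`, and the Goursat data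
`K(x,x) = h/2 + (1/2)∫₀ˣ q` and `K(x,−x) = h/2`. -/
def IsTransmutationKernel (b : ℝ) (q : ℝ → ℂ) (h : ℂ) (K : ℝ → ℝ → ℂ) : Prop :=
  ContDiffOn ℝ 2 (fun p : ℝ × ℝ => K p.1 p.2) (Set.Icc (-b) b ×ˢ Set.Icc (-b) b) ∧
  (∀ x ∈ Set.Icc (-b) b, ∀ t ∈ Set.Icc (-b) b, d2x b K x t - q x * K x t = d2t b K x t) ∧
  (∀ x ∈ Set.Icc (-b) b, K x x = h / 2 + (1 / 2) * ∫ s in (0:ℝ)..x, q s) ∧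
  (∀ x ∈ Set.Icc (-b) b, K x (-x) = h / 2)

section Leibniz

variable {E : Type*} [NormedAddCommGroup E] [NormedSpace ℝ E]

/-- Leibniz rule for an integral with variable upper limit. -/
theorem hasDerivAt_integral_upper [CompleteSpace E] {f f' : ℝ → ℝ → E} (hf : Continuous (Function.uncurry f))
    (hf' : Continuous (Function.uncurry f')) (hd : ∀ x t, HasDerivAt (fun y => f y t) (f' x t) x)
    {s : ℝ → ℝ} {s' x : ℝ} (hs : HasDerivAt s s' x) :
    HasDerivAt (fun y => ∫ t in (0 : ℝ)..s y, f y t)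
      ((∫ t in (0 : ℝ)..s x, f' x t) + s' • f x (s x)) x := by
  let L : E →L[ℝ] (ℝ →L[ℝ] E) := ContinuousLinearMap.toSpanSingletonCLE.toContinuousLinearMap
  have hpar : ∀ x y, HasDerivAt (fun z => ∫ t in (0 : ℝ)..y, f z t) (∫ t in (0 : ℝ)..y, f' x t) x := by
    intro x y
    obtain ⟨M, hM⟩ := ((isCompact_closedBall x 1).prod (isCompact_uIcc (a := 0) (b := y))).bddAbove_image
      hf'.norm.continuousOn
    refine (intervalIntegral.hasDerivAt_integral_of_dominated_loc_of_deriv_le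
      (F := f) (F' := f') (bound := fun _ => M) (Metric.closedBall_mem_nhds x one_pos)
      (.of_forall fun z => (hf.uncurry_left z).aestronglyMeasurable)
      ((hf.uncurry_left x).intervalIntegrable _ _)
      (hf'.uncurry_left x).aestronglyMeasurable ?_ intervalIntegrable_const ?_).2
    · refine .of_forall fun t ht z hz => ?_
      exact hM (mem_image_of_mem (fun p : ℝ × ℝ => ‖Function.uncurry f' p‖)
        (mk_mem_prod hz (uIoc_subset_uIcc ht)))
    · exact .of_forall fun t _ z _ => hd z t
  have key := hasStrictFDerivAt_uncurry_coprod (𝕜 := ℝ) (u := (x, s x))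
    (f := fun z y => ∫ t in (0 : ℝ)..y, f z t)
    (f₁ := fun z y => L (∫ t in (0 : ℝ)..y, f' z t)) (f₂ := fun z y => L (f z y))
    (.of_forall fun v => (hpar v.1 v.2).hasFDerivAt)
    (.of_forall fun v => ((hf.uncurry_left v.1).integral_hasStrictDerivAt 0 v.2).hasDerivAt.hasFDerivAt)
    (L.continuous.comp
      (intervalIntegral.continuous_parametric_primitive_of_continuous hf')).continuousAt
    (L.continuous.comp hf).continuousAt
  have := key.hasFDerivAt.comp_hasDerivAt x ((hasDerivAt_id x).prodMk hs)
  convert! this using 1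
  simp [L, Function.HasUncurry.uncurry]

/-- Leibniz rule for the symmetric integral `∫_{-x}^{x} f(x,t) dt`. -/
theorem hasDerivAt_integral_symm [CompleteSpace E] {f f' : ℝ → ℝ → E} (hf : Continuous (Function.uncurry f))
    (hf' : Continuous (Function.uncurry f')) (hd : ∀ x t, HasDerivAt (fun y => f y t) (f' x t) x)
    (x : ℝ) :
    HasDerivAt (fun y => ∫ t in (-y)..y, f y t)
      (f x x + f x (-x) + ∫ t in (-x)..x, f' x t) x := by
  have h1 := hasDerivAt_integral_upper hf hf' hd (hasDerivAt_id x)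
  have h2 := hasDerivAt_integral_upper hf hf' hd (hasDerivAt_neg x)
  have split : ∀ {g : ℝ → E}, Continuous g → ∀ y : ℝ,
      ∫ t in (-y)..y, g t = (∫ t in (0 : ℝ)..y, g t) - ∫ t in (0 : ℝ)..(-y), g t := fun hg y =>
    (intervalIntegral.integral_interval_sub_left (hg.intervalIntegrable _ _)
      (hg.intervalIntegrable _ _)).symm
  simp_rw [fun y => split (hf.uncurry_left y) y]
  rw [split (hf'.uncurry_left x)]
  convert! h1.sub h2 using 1
  simp only [id, one_smul, neg_smul]
  abel

/-- The projection of the real line onto `[-b,b]`. -/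
def clampIcc (b x : ℝ) : ℝ := max (-b) (min b x)

theorem continuous_clampIcc (b : ℝ) : Continuous (clampIcc b) := by
  unfold clampIcc; fun_prop

theorem clampIcc_mem {b : ℝ} (hb : 0 < b) (x : ℝ) : clampIcc b x ∈ Icc (-b) b :=
  ⟨le_max_left _ _, max_le (by linarith) (min_le_left _ _)⟩

theorem clampIcc_of_mem {b x : ℝ} (hx : x ∈ Icc (-b) b) : clampIcc b x = x := by
  rw [clampIcc, min_eq_right hx.2, max_eq_right hx.1]

theorem neg_mem_symm_Icc {b x : ℝ} (hx : x ∈ Icc (-b) b) : -x ∈ Icc (-b) b :=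
  ⟨by linarith [hx.2], by linarith [hx.1]⟩

theorem uIcc_neg_subset {b x : ℝ} (hx : x ∈ Icc (-b) b) : uIcc (-x) x ⊆ Icc (-b) b :=
  (ordConnected_Icc).uIcc_subset (neg_mem_symm_Icc hx) hx

theorem continuous_comp_clampIcc {F : Type*} [TopologicalSpace F] {b : ℝ} (hb : 0 < b)
    {f : ℝ → ℝ → F}
    (hf : ContinuousOn (Function.uncurry f) (Icc (-b) b ×ˢ Icc (-b) b)) :
    Continuous (Function.uncurry fun x t => f (clampIcc b x) (clampIcc b t)) :=
  hf.comp_continuous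
    (((continuous_clampIcc b).comp continuous_fst).prodMk
      ((continuous_clampIcc b).comp continuous_snd))
    fun p => ⟨clampIcc_mem hb p.1, clampIcc_mem hb p.2⟩

theorem continuousOn_integral_symm {b : ℝ} (hb : 0 < b) {f : ℝ → ℝ → E}
    (hf : ContinuousOn (Function.uncurry f) (Icc (-b) b ×ˢ Icc (-b) b)) :
    ContinuousOn (fun x => ∫ t in (-x)..x, f x t) (Icc (-b) b) := by
  have hc := continuous_comp_clampIcc hb hf
  have h : Continuous fun x => (∫ t in (0 : ℝ)..x, f (clampIcc b x) (clampIcc b t)) -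
      ∫ t in (0 : ℝ)..(-x), f (clampIcc b x) (clampIcc b t) :=
    (intervalIntegral.continuous_parametric_intervalIntegral_of_continuous hc continuous_id).sub
      (intervalIntegral.continuous_parametric_intervalIntegral_of_continuous hc continuous_neg)
  refine h.continuousOn.congr fun x hx => ?_
  dsimp only
  rw [intervalIntegral.integral_interval_sub_left ((hc.uncurry_left x).intervalIntegrable _ _)
      ((hc.uncurry_left x).intervalIntegrable _ _)]
  refine intervalIntegral.integral_congr fun t ht => ?_
  simp only [clampIcc_of_mem hx, clampIcc_of_mem (uIcc_neg_subset hx ht)]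

/-- Leibniz rule on `[-b,b]` for `∫_{-x}^{x} f(x,t) dt`, with one-sided derivatives at the
endpoints. -/
theorem hasDerivWithinAt_integral_symm [CompleteSpace E] {b : ℝ} (hb : 0 < b) {f f' : ℝ → ℝ → E}
    (hf : ContinuousOn (Function.uncurry f) (Icc (-b) b ×ˢ Icc (-b) b))
    (hf' : ContinuousOn (Function.uncurry f') (Icc (-b) b ×ˢ Icc (-b) b))
    (hd : ∀ x ∈ Icc (-b) b, ∀ t ∈ Icc (-b) b,
      HasDerivWithinAt (fun y => f y t) (f' x t) (Icc (-b) b) x)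
    {x : ℝ} (hx : x ∈ Icc (-b) b) :
    HasDerivWithinAt (fun y => ∫ t in (-y)..y, f y t)
      (f x x + f x (-x) + ∫ t in (-x)..x, f' x t) (Icc (-b) b) x := by
  have h0 : (0 : ℝ) ∈ Icc (-b) b := ⟨by linarith, hb.le⟩
  have hc' := continuous_comp_clampIcc hb hf'
  let g' : ℝ → ℝ → E := fun x t => f' (clampIcc b x) (clampIcc b t)
  let g : ℝ → ℝ → E := fun x t => f 0 (clampIcc b t) + ∫ s in (0 : ℝ)..x, g' s t
  have hgc : Continuous (Function.uncurry g) := by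
    refine Continuous.add ?_ ?_
    · exact hf.comp_continuous
        (continuous_const.prodMk ((continuous_clampIcc b).comp continuous_snd))
        fun p => ⟨h0, clampIcc_mem hb p.2⟩
    · exact intervalIntegral.continuous_parametric_intervalIntegral_of_continuous
        (f := fun (p : ℝ × ℝ) s => g' s p.2)
        (hc'.comp (continuous_snd.prodMk (continuous_snd.comp continuous_fst))) continuous_fst
  have hgd : ∀ x t, HasDerivAt (fun y => g y t) (g' x t) x := fun x t =>
    (((hc'.uncurry_right t).integral_hasStrictDerivAt 0 x).hasDerivAt).const_add _
  have hgf : ∀ y ∈ Icc (-b) b, ∀ t ∈ Icc (-b) b, g y t = f y t := by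
    intro y hy t ht
    have hsub : uIcc 0 y ⊆ Icc (-b) b := ordConnected_Icc.uIcc_subset h0 hy
    have hI : ∫ s in (0 : ℝ)..y, g' s t = f y t - f 0 t := by
      refine intervalIntegral.integral_eq_sub_of_hasDeriv_right (f := fun s => f s t)
        (fun s hs => ((hd s (hsub hs) t ht).mono hsub).continuousWithinAt) (fun s hs => ?_)
        ((hc'.uncurry_right t).intervalIntegrable _ _)
      have hs' := hsub (Ioo_subset_Icc_self hs)
      have hD := (((hd s hs' t ht).mono hsub).hasDerivAt
        (Icc_mem_nhds hs.1 hs.2)).hasDerivWithinAt (s := Ioi s)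
      simpa only [g', clampIcc_of_mem hs', clampIcc_of_mem ht] using hD
    simp only [g, hI, clampIcc_of_mem ht, add_sub_cancel]
  have main := (hasDerivAt_integral_symm hgc hc' hgd x).hasDerivWithinAt (s := Icc (-b) b)
  have hint : ∀ y ∈ Icc (-b) b, ∫ t in (-y)..y, g y t = ∫ t in (-y)..y, f y t := fun y hy =>
    intervalIntegral.integral_congr fun t ht => hgf y hy t (uIcc_neg_subset hy ht)
  have hint' : ∫ t in (-x)..x, g' x t = ∫ t in (-x)..x, f' x t :=
    intervalIntegral.integral_congr fun t ht => by
      simp only [g', clampIcc_of_mem hx, clampIcc_of_mem (uIcc_neg_subset hx ht)]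
  rw [hgf x hx x hx, hgf x hx _ (neg_mem_symm_Icc hx), hint'] at main
  exact main.congr (fun y hy => (hint y hy).symm) (hint x hx).symm

end Leibniz

section Partial

variable {E : Type*} [NormedAddCommGroup E] [NormedSpace ℝ E]

theorem ContDiffOn.exists_partials {b : ℝ} (hb : 0 < b) {n : ℕ} {f : ℝ → ℝ → E}
    (hf : ContDiffOn ℝ (n + 1) (Function.uncurry f) (Icc (-b) b ×ˢ Icc (-b) b)) :
    ∃ f₁ f₂ : ℝ → ℝ → E,
      ContDiffOn ℝ n (Function.uncurry f₁) (Icc (-b) b ×ˢ Icc (-b) b) ∧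
      ContDiffOn ℝ n (Function.uncurry f₂) (Icc (-b) b ×ˢ Icc (-b) b) ∧
      ∀ (α β : ℝ → ℝ) (α' β' : ℝ), ∀ s ∈ Icc (-b) b,
        MapsTo α (Icc (-b) b) (Icc (-b) b) → MapsTo β (Icc (-b) b) (Icc (-b) b) →
        HasDerivAt α α' s → HasDerivAt β β' s →
        HasDerivWithinAt (fun r => f (α r) (β r)) (α' • f₁ (α s) (β s) + β' • f₂ (α s) (β s))
          (Icc (-b) b) s := by
  have hI : UniqueDiffOn ℝ (Icc (-b) b) := uniqueDiffOn_Icc (by linarith)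
  have hS := hI.prod hI
  have hD := hf.fderivWithin hS le_rfl
  refine ⟨fun x t => fderivWithin ℝ (Function.uncurry f) (Icc (-b) b ×ˢ Icc (-b) b) (x, t) (1, 0),
    fun x t => fderivWithin ℝ (Function.uncurry f) (Icc (-b) b ×ˢ Icc (-b) b) (x, t) (0, 1),
    hD.clm_apply contDiffOn_const, hD.clm_apply contDiffOn_const, ?_⟩
  intro α β α' β' s hs hα hβ hα' hβ'
  have h1 := (hf.differentiableOn (by simp) (α s, β s) ⟨hα hs, hβ hs⟩).hasFDerivWithinAt
  have h2 := h1.comp_hasDerivWithinAt s (hα'.prodMk hβ').hasDerivWithinAt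
    (fun r hr => mk_mem_prod (hα hr) (hβ hr))
  convert! h2 using 1
  rw [← map_smul, ← map_smul, ← map_add]
  simp

theorem contDiffOn_two_of_hasDerivWithinAt {s : Set ℝ} (hs : UniqueDiffOn ℝ s) {f f' f'' : ℝ → E}
    (hf : ∀ x ∈ s, HasDerivWithinAt f (f' x) s x) (hf' : ∀ x ∈ s, HasDerivWithinAt f' (f'' x) s x)
    (hc : ContinuousOn f'' s) : ContDiffOn ℝ 2 f s := by
  have h1 : ∀ x ∈ s, derivWithin f s x = f' x := fun x hx => (hf x hx).derivWithin (hs x hx)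
  have h2 : ∀ x ∈ s, derivWithin f' s x = f'' x := fun x hx => (hf' x hx).derivWithin (hs x hx)
  rw [← one_add_one_eq_two, contDiffOn_succ_iff_derivWithin hs]
  refine ⟨fun x hx => (hf x hx).differentiableWithinAt, by simp, ?_⟩
  refine ContDiffOn.congr ?_ h1
  rw [contDiffOn_one_iff_derivWithin hs]
  exact ⟨fun x hx => (hf' x hx).differentiableWithinAt, hc.congr h2⟩

end Partial

/-- the operator `T u (x) = u(x) + ∫_{−x}^{x} K(x,t) u(t) dt` maps
`C²[-b,b]` into itself and satisfies `(−d²/dx² + q) T[u] = T[−u'']`. -/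
theorem transmutation_operator_transmutes
    (b : ℝ) (hb : 0 < b) (q : ℝ → ℂ) (hq : ContDiffOn ℝ 1 q (Set.Icc (-b) b))
    (h : ℂ) (K : ℝ → ℝ → ℂ) (hK : IsTransmutationKernel b q h K)
    (u : ℝ → ℂ) (hu : ContDiffOn ℝ 2 u (Set.Icc (-b) b)) :
    ContDiffOn ℝ 2 (fun x => u x + ∫ t in (-x)..x, K x t * u t) (Set.Icc (-b) b) ∧
    ∀ x ∈ Set.Icc (-b) b,
      -(derivWithin
          (derivWithin (fun y => u y + ∫ t in (-y)..y, K y t * u t) (Set.Icc (-b) b))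
          (Set.Icc (-b) b) x)
        + q x * (u x + ∫ t in (-x)..x, K x t * u t)
      = -(derivWithin (derivWithin u (Set.Icc (-b) b)) (Set.Icc (-b) b) x)
        - ∫ t in (-x)..x, K x t * derivWithin (derivWithin u (Set.Icc (-b) b)) (Set.Icc (-b) b) t := by
  obtain ⟨hK2, hpde, hdiag, hanti⟩ := hK
  set I := Icc (-b) b
  have hI : UniqueDiffOn ℝ I := uniqueDiffOn_Icc (by linarith)
  have h0 : (0 : ℝ) ∈ I := ⟨by linarith, hb.le⟩
  obtain ⟨Kx, Kt, hKx, hKt, hKd⟩ := ContDiffOn.exists_partials hb (n := 1) (f := K) hK2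
  obtain ⟨Kxx, Kxt, hKxx, -, hKxd⟩ := ContDiffOn.exists_partials hb (n := 0) (f := Kx) hKx
  obtain ⟨Ktx, Ktt, -, hKtt, hKtd⟩ := ContDiffOn.exists_partials hb (n := 0) (f := Kt) hKt
  have dx : ∀ {f f₁ f₂ : ℝ → ℝ → ℂ}, (∀ (α β : ℝ → ℝ) (α' β' : ℝ), ∀ s ∈ I,
        MapsTo α I I → MapsTo β I I → HasDerivAt α α' s → HasDerivAt β β' s →
        HasDerivWithinAt (fun r => f (α r) (β r))
          (α' • f₁ (α s) (β s) + β' • f₂ (α s) (β s)) I s) →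
      ∀ x ∈ I, ∀ t ∈ I, HasDerivWithinAt (fun y => f y t) (f₁ x t) I x := by
    intro f f₁ f₂ H x hx t ht
    simpa using H (fun y => y) (fun _ => t) 1 0 x hx (fun _ h => h) (fun _ _ => ht)
      (hasDerivAt_id x) (hasDerivAt_const x t)
  have dt : ∀ {f f₁ f₂ : ℝ → ℝ → ℂ}, (∀ (α β : ℝ → ℝ) (α' β' : ℝ), ∀ s ∈ I,
        MapsTo α I I → MapsTo β I I → HasDerivAt α α' s → HasDerivAt β β' s →
        HasDerivWithinAt (fun r => f (α r) (β r))
          (α' • f₁ (α s) (β s) + β' • f₂ (α s) (β s)) I s) →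
      ∀ x ∈ I, ∀ t ∈ I, HasDerivWithinAt (fun y => f x y) (f₂ x t) I t := by
    intro f f₁ f₂ H x hx t ht
    simpa using H (fun _ => x) (fun y => y) 0 1 t ht (fun _ _ => hx) (fun _ h => h)
      (hasDerivAt_const t x) (hasDerivAt_id t)
  have eq_xx : ∀ x ∈ I, ∀ t ∈ I, d2x b K x t = Kxx x t := by
    intro x hx t ht
    have h1 : ∀ y ∈ I, derivWithin (fun z => K z t) I y = Kx y t := fun y hy =>
      (dx hKd y hy t ht).derivWithin (hI y hy)
    exact (derivWithin_congr h1 (h1 x hx)).trans ((dx hKxd x hx t ht).derivWithin (hI x hx))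
  have eq_tt : ∀ x ∈ I, ∀ t ∈ I, d2t b K x t = Ktt x t := by
    intro x hx t ht
    have h1 : ∀ y ∈ I, derivWithin (fun z => K x z) I y = Kt x y := fun y hy =>
      (dt hKd x hx y hy).derivWithin (hI y hy)
    exact (derivWithin_congr h1 (h1 t ht)).trans ((dt hKtd x hx t ht).derivWithin (hI t ht))
  have hqc : Continuous fun x => q (clampIcc b x) :=
    hq.continuousOn.comp_continuous (continuous_clampIcc b) (clampIcc_mem hb)
  have hdiag' : ∀ x ∈ I, HasDerivWithinAt (fun y => K y y) (q x / 2) I x := by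
    intro x hx
    have h1 := (((hqc.integral_hasStrictDerivAt 0 x).hasDerivAt.const_mul
      (1 / 2 : ℂ)).const_add (h / 2)).hasDerivWithinAt (s := I)
    rw [clampIcc_of_mem hx, one_div_mul_eq_div] at h1
    have h2 : ∀ y ∈ I, K y y = h / 2 + 1 / 2 * ∫ s in (0 : ℝ)..y, q (clampIcc b s) := by
      intro y hy
      rw [hdiag y hy]
      congr 2
      refine intervalIntegral.integral_congr fun s hs => ?_
      simp only [clampIcc_of_mem (ordConnected_Icc.uIcc_subset h0 hy hs)]
    exact h1.congr h2 (h2 x hx)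
  have char_diag : ∀ x ∈ I, Kx x x + Kt x x = q x / 2 := by
    intro x hx
    have h1 := hKd (fun y => y) (fun y => y) 1 1 x hx (fun _ h => h) (fun _ h => h)
      (hasDerivAt_id x) (hasDerivAt_id x)
    simpa using (hI x hx).eq_deriv _ h1 (hdiag' x hx)
  have char_anti : ∀ x ∈ I, Kx x (-x) - Kt x (-x) = 0 := by
    intro x hx
    have h1 := hKd (fun y => y) (fun y => -y) 1 (-1) x hx (fun _ h => h)
      (fun _ h => neg_mem_symm_Icc h) (hasDerivAt_id x) (hasDerivAt_neg x)
    have h2 : HasDerivWithinAt (fun y => K y (-y)) 0 I x :=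
      (hasDerivWithinAt_const x I (h / 2)).congr hanti (hanti x hx)
    simpa [sub_eq_add_neg] using (hI x hx).eq_deriv _ h1 h2
  set u' := derivWithin u I
  set u'' := derivWithin u' I
  have hu2 := (contDiffOn_succ_iff_derivWithin (n := 1) hI).1 (by simpa using! hu)
  have hu1 := (contDiffOn_one_iff_derivWithin hI).1 hu2.2.2
  have du : ∀ x ∈ I, HasDerivWithinAt u (u' x) I x := fun x hx => (hu2.1 x hx).hasDerivWithinAt
  have du' : ∀ x ∈ I, HasDerivWithinAt u' (u'' x) I x := fun x hx => (hu1.1 x hx).hasDerivWithinAt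
  have cu'' : ContinuousOn u'' I := hu1.2
  have mulc : ∀ {f : ℝ → ℝ → ℂ} {v : ℝ → ℂ}, ContinuousOn (Function.uncurry f) (I ×ˢ I) →
      ContinuousOn v I → ContinuousOn (Function.uncurry fun x t => f x t * v t) (I ×ˢ I) :=
    fun hf hv => hf.mul (hv.comp continuousOn_snd fun p hp => hp.2)
  have cK : ContinuousOn (Function.uncurry K) (I ×ˢ I) := hK2.continuousOn
  have cu := hu.continuousOn
  have dF : ∀ x ∈ I, HasDerivWithinAt (fun y => ∫ t in (-y)..y, K y t * u t)
      (K x x * u x + K x (-x) * u (-x) + ∫ t in (-x)..x, Kx x t * u t) I x := fun x hx =>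
    hasDerivWithinAt_integral_symm hb (mulc cK cu) (mulc hKx.continuousOn cu)
      (fun x hx t ht => (dx hKd x hx t ht).mul_const _) hx
  have dF' : ∀ x ∈ I, HasDerivWithinAt (fun y => ∫ t in (-y)..y, Kx y t * u t)
      (Kx x x * u x + Kx x (-x) * u (-x) + ∫ t in (-x)..x, Kxx x t * u t) I x := fun x hx =>
    hasDerivWithinAt_integral_symm hb (mulc hKx.continuousOn cu) (mulc hKxx.continuousOn cu)
      (fun x hx t ht => (dx hKxd x hx t ht).mul_const _) hx
  have slice : ∀ {f : ℝ → ℝ → ℂ}, ContinuousOn (Function.uncurry f) (I ×ˢ I) →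
      ∀ x ∈ I, ContinuousOn (f x) I := fun hf x hx =>
    hf.comp (continuousOn_const.prodMk continuousOn_id) fun t ht => ⟨hx, ht⟩
  have parts : ∀ x ∈ I, ∫ t in (-x)..x, Kxx x t * u t =
      Kt x x * u x - Kt x (-x) * u (-x) - K x x * u' x + K x (-x) * u' (-x)
        + (∫ t in (-x)..x, K x t * u'' t) + q x * ∫ t in (-x)..x, K x t * u t := by
    intro x hx
    have hsub : uIcc (-x) x ⊆ I := uIcc_neg_subset hx
    have ii : ∀ {v : ℝ → ℂ}, ContinuousOn v I → IntervalIntegrable v volume (-x) x :=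
      fun hv => (hv.mono hsub).intervalIntegrable
    have sK := slice cK x hx
    have sKt := slice hKt.continuousOn x hx
    have sKtt := slice hKtt.continuousOn x hx
    have p1 := intervalIntegral.integral_mul_deriv_eq_deriv_mul_of_hasDerivWithinAt
      (fun t ht => (dt hKd x hx t (hsub ht)).mono hsub) (fun t ht => (du' t (hsub ht)).mono hsub)
      (ii sKt) (ii cu'')
    have p2 := intervalIntegral.integral_mul_deriv_eq_deriv_mul_of_hasDerivWithinAt
      (fun t ht => (dt hKtd x hx t (hsub ht)).mono hsub) (fun t ht => (du t (hsub ht)).mono hsub)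
      (ii sKtt) (ii hu2.2.2.continuousOn)
    have p3 : ∫ t in (-x)..x, Kxx x t * u t =
        (∫ t in (-x)..x, Ktt x t * u t) + q x * ∫ t in (-x)..x, K x t * u t := by
      rw [← intervalIntegral.integral_const_mul, ← intervalIntegral.integral_add
        (by exact ii (sKtt.mul cu)) (by exact (ii (sK.mul cu)).const_mul _)]
      refine intervalIntegral.integral_congr fun t ht => ?_
      have := hpde x hx t (hsub ht)
      rw [eq_xx x hx t (hsub ht), eq_tt x hx t (hsub ht)] at this
      simp only [← this]
      ring
    rw [p3, p1, p2]
    ring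
  have dT : ∀ x ∈ I, HasDerivWithinAt (fun y => u y + ∫ t in (-y)..y, K y t * u t)
      (u' x + (K x x * u x + h / 2 * u (-x) + ∫ t in (-x)..x, Kx x t * u t)) I x := by
    intro x hx
    rw [← hanti x hx]
    exact (du x hx).add (dF x hx)
  have dT' : ∀ x ∈ I, HasDerivWithinAt
      (fun x => u' x + (K x x * u x + h / 2 * u (-x) + ∫ t in (-x)..x, Kx x t * u t))
      (u'' x + q x * (u x + ∫ t in (-x)..x, K x t * u t) + ∫ t in (-x)..x, K x t * u'' t) I x := by
    intro x hx
    have dneg : HasDerivWithinAt (fun y => u (-y)) (-u' (-x)) I x := by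
      simpa [Function.comp_def] using! (du (-x) (neg_mem_symm_Icc hx)).scomp x (hasDerivAt_neg x).hasDerivWithinAt
        (fun y hy => neg_mem_symm_Icc hy)
    refine ((du' x hx).add ((((hdiag' x hx).mul (du x hx)).add
      (dneg.const_mul (h / 2))).add (dF' x hx))).congr_deriv ?_
    rw [parts x hx]
    linear_combination u x * char_diag x hx + u (-x) * char_anti x hx + u' (-x) * hanti x hx
  refine ⟨contDiffOn_two_of_hasDerivWithinAt hI dT dT' ?_, fun x hx => ?_⟩
  · exact (cu''.add (hq.continuousOn.mul (cu.add (continuousOn_integral_symm hb (mulc cK cu))))).add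
      (continuousOn_integral_symm hb (mulc cK cu''))
  · have e : ∀ y ∈ I, derivWithin (fun y => u y + ∫ t in (-y)..y, K y t * u t) I y = _ :=
      fun y hy => (dT y hy).derivWithin (hI y hy)
    rw [derivWithin_congr e (e x hx), (dT' x hx).derivWithin (hI x hx)]
    ring
end

section
/- For every λ ∈ ℂ and every function y ∈ C²(a,b) ∩ C¹[a,b] satisfying y'' − q·y = λ·y on (a,b), there exist unique constants c₁, c₂ ∈ ℂ such that y = c₁·y₁ + c₂·y₂ on [a,b], where y₁ := Σ_{k=0}^∞ (λᵏ/(2k)!)·φ_{2k} and y₂ := Σ_{k=0}^∞ (λᵏ/(2k+1)!)·φ_{2k+1}. -/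
open Set MeasureTheory Filter

/-- The recursive integrals `X⁽⁰⁾ ≡ 1`, `X⁽ⁿ⁾(x) = n ∫_{x₀}^x X⁽ⁿ⁻¹⁾(s) (f(s)²)^((−1)ⁿ) ds`. -/
noncomputable def Xrec (x₀ : ℝ) (f : ℝ → ℂ) : ℕ → ℝ → ℂ
  | 0 => fun _ => 1
  | n + 1 => fun x => ((n : ℂ) + 1) * ∫ s in x₀..x, Xrec x₀ f n s * (f s ^ 2) ^ ((-1 : ℤ) ^ (n + 1))

/-- The recursive integrals `X̃⁽⁰⁾ ≡ 1`, `X̃⁽ⁿ⁾(x) = n ∫_{x₀}^x X̃⁽ⁿ⁻¹⁾(s) (f(s)²)^((−1)^(n−1)) ds`. -/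
noncomputable def Xtrec (x₀ : ℝ) (f : ℝ → ℂ) : ℕ → ℝ → ℂ
  | 0 => fun _ => 1
  | n + 1 => fun x => ((n : ℂ) + 1) * ∫ s in x₀..x, Xtrec x₀ f n s * (f s ^ 2) ^ ((-1 : ℤ) ^ n)

/-- `φ_k = f·X⁽ᵏ⁾` for odd `k`, `φ_k = f·X̃⁽ᵏ⁾` for even `k`. -/
noncomputable def phiF (x₀ : ℝ) (f : ℝ → ℂ) (k : ℕ) (x : ℝ) : ℂ :=
  if Odd k then f x * Xrec x₀ f k x else f x * Xtrec x₀ f k x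

/-- `ψ_k = X̃⁽ᵏ⁾/f` for odd `k`, `ψ_k = X⁽ᵏ⁾/f` for even `k`. -/
noncomputable def psiF (x₀ : ℝ) (f : ℝ → ℂ) (k : ℕ) (x : ℝ) : ℂ :=
  if Odd k then Xtrec x₀ f k x / f x else Xrec x₀ f k x / f x

/-- The SPPS solution `y₁ = Σ_{k=0}^∞ (λᵏ/(2k)!) φ_{2k}`. -/
noncomputable def sppsY1 (x₀ : ℝ) (f : ℝ → ℂ) (lam : ℂ) (x : ℝ) : ℂ :=
  ∑' k : ℕ, lam ^ k / (Nat.factorial (2 * k) : ℂ) * phiF x₀ f (2 * k) x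

/-- The SPPS solution `y₂ = Σ_{k=0}^∞ (λᵏ/(2k+1)!) φ_{2k+1}`. -/
noncomputable def sppsY2 (x₀ : ℝ) (f : ℝ → ℂ) (lam : ℂ) (x : ℝ) : ℂ :=
  ∑' k : ℕ, lam ^ k / (Nat.factorial (2 * k + 1) : ℂ) * phiF x₀ f (2 * k + 1) x

/-- Iterated integrals `J⁽⁰⁾ = v`, `J⁽ⁿ⁺¹⁾(x) = ∫_{x₀}^x J⁽ⁿ⁾ wₙ` with weights `w`. -/
noncomputable def iterInt (x₀ : ℝ) (w : ℕ → ℝ → ℂ) (v : ℝ → ℂ) : ℕ → ℝ → ℂ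
  | 0 => v
  | n + 1 => fun x => ∫ s in x₀..x, iterInt x₀ w v n s * w n s

theorem iterInt_add (x₀ : ℝ) (w : ℕ → ℝ → ℂ) (v : ℝ → ℂ) (m n : ℕ) :
    iterInt x₀ w v (m + n) = iterInt x₀ (fun k => w (m + k)) (iterInt x₀ w v m) n := by
  induction n with
  | zero => rfl
  | succ n ih =>
    funext x
    change ∫ s in x₀..x, iterInt x₀ w v (m + n) s * w (m + n) s = _
    rw [ih]
    rfl

section Interval

variable {a b x₀ : ℝ}

theorem intervalIntegrable_of_continuousOn_Icc {g : ℝ → ℂ} (hg : ContinuousOn g (Icc a b))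
    (hx₀ : x₀ ∈ Icc a b) {x : ℝ} (hx : x ∈ Icc a b) : IntervalIntegrable g volume x₀ x :=
  (hg.mono (uIcc_subset_Icc hx₀ hx)).intervalIntegrable

theorem continuousOn_iterInt {w : ℕ → ℝ → ℂ} {v : ℝ → ℂ} (hx₀ : x₀ ∈ Icc a b)
    (hw : ∀ n, ContinuousOn (w n) (Icc a b)) (hv : ContinuousOn v (Icc a b)) (n : ℕ) :
    ContinuousOn (iterInt x₀ w v n) (Icc a b) := by
  have hab : a ≤ b := hx₀.1.trans hx₀.2
  induction n with
  | zero => exact hv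
  | succ n ih =>
    have hc : ContinuousOn (fun s => iterInt x₀ w v n s * w n s) (uIcc a b) := by
      rw [uIcc_of_le hab]
      exact ih.mul (hw n)
    have h := intervalIntegral.continuousOn_primitive_interval' (a := x₀) (μ := volume)
      hc.intervalIntegrable (by rwa [uIcc_of_le hab])
    rwa [uIcc_of_le hab] at h

theorem norm_iterInt_le {w : ℕ → ℝ → ℂ} {v : ℝ → ℂ} {C M : ℝ} (hx₀ : x₀ ∈ Icc a b)
    (hC : ∀ n, ∀ x ∈ Icc a b, ‖w n x‖ ≤ C) (hM : ∀ x ∈ Icc a b, ‖v x‖ ≤ M) (n : ℕ) :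
    ∀ x ∈ Icc a b, ‖iterInt x₀ w v n x‖ ≤ M * ((C * |x - x₀|) ^ n / n.factorial) := by
  have hM0 : 0 ≤ M := (norm_nonneg _).trans (hM _ hx₀)
  have hC0 : 0 ≤ C := (norm_nonneg _).trans (hC 0 _ hx₀)
  induction n with
  | zero => simpa [iterInt] using hM
  | succ n ih =>
    intro x hx
    have hsub : uIoc x₀ x ⊆ Icc a b := uIoc_subset_uIcc.trans (uIcc_subset_Icc hx₀ hx)
    calc ‖∫ s in x₀..x, iterInt x₀ w v n s * w n s‖
        ≤ ∫ s in uIoc x₀ x, ‖iterInt x₀ w v n s * w n s‖ :=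
          intervalIntegral.norm_integral_le_integral_norm_uIoc
      _ ≤ ∫ s in uIoc x₀ x, M * C ^ (n + 1) / n.factorial * |s - x₀| ^ n := by
          apply integral_mono_of_nonneg (Eventually.of_forall fun _ => norm_nonneg _)
          · have hcont : Continuous fun s : ℝ => M * C ^ (n + 1) / n.factorial * |s - x₀| ^ n := by
              fun_prop
            exact intervalIntegrable_iff.1 (hcont.intervalIntegrable x₀ x)
          · filter_upwards [ae_restrict_mem measurableSet_uIoc] with s hs
            have hs' := hsub hs
            calc ‖iterInt x₀ w v n s * w n s‖
                ≤ M * ((C * |s - x₀|) ^ n / n.factorial) * C := by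
                  rw [norm_mul]
                  exact mul_le_mul (ih s hs') (hC n s hs') (norm_nonneg _) (by positivity)
              _ = _ := by rw [mul_pow]; ring
      _ = M * ((C * |x - x₀|) ^ (n + 1) / (n + 1).factorial) := by
          rw [integral_const_mul, integral_pow_abs_sub_uIoc, Nat.factorial_succ, mul_pow]
          push_cast
          field_simp

theorem iterInt_add_add_mul {w : ℕ → ℝ → ℂ} {u v₁ v₂ v₃ : ℝ → ℂ} (hx₀ : x₀ ∈ Icc a b)
    (hw : ∀ n, ContinuousOn (w n) (Icc a b)) (h₁ : ContinuousOn v₁ (Icc a b))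
    (h₂ : ContinuousOn v₂ (Icc a b)) (h₃ : ContinuousOn v₃ (Icc a b)) (c₁ c₂ c₃ : ℂ)
    (hu : ∀ x ∈ Icc a b, u x = c₁ * v₁ x + c₂ * v₂ x + c₃ * v₃ x) (n : ℕ) :
    ∀ x ∈ Icc a b, iterInt x₀ w u n x =
      c₁ * iterInt x₀ w v₁ n x + c₂ * iterInt x₀ w v₂ n x + c₃ * iterInt x₀ w v₃ n x := by
  induction n with
  | zero => exact hu
  | succ n ih =>
    intro x hx
    have hvw : ∀ {v : ℝ → ℂ} (c : ℂ), ContinuousOn v (Icc a b) →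
        IntervalIntegrable (fun s => c * (iterInt x₀ w v n s * w n s)) volume x₀ x :=
      fun c hv => (intervalIntegrable_of_continuousOn_Icc
        ((continuousOn_iterInt hx₀ hw hv n).mul (hw n)) hx₀ hx).const_mul c
    simp only [iterInt]
    rw [← intervalIntegral.integral_const_mul, ← intervalIntegral.integral_const_mul,
      ← intervalIntegral.integral_const_mul,
      ← intervalIntegral.integral_add (hvw c₁ h₁) (hvw c₂ h₂),
      ← intervalIntegral.integral_add ((hvw c₁ h₁).add (hvw c₂ h₂)) (hvw c₃ h₃)]
    refine intervalIntegral.integral_congr fun s hs => ?_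
    simp only [ih s (uIcc_subset_Icc hx₀ hx hs)]
    ring

/-- Picard iteration for the system `u' = p w₁`, `p' = λ u w₀` with 2-periodic weights. -/
theorem tendsto_sum_iterInt_of_integral_eq {w : ℕ → ℝ → ℂ} {C : ℝ} (hx₀ : x₀ ∈ Icc a b)
    (hw : ∀ n, ContinuousOn (w n) (Icc a b)) (hC : ∀ n, ∀ x ∈ Icc a b, ‖w n x‖ ≤ C)
    (hper : ∀ n, w (2 + n) = w n) {u p : ℝ → ℂ} (hu : ContinuousOn u (Icc a b)) (lam : ℂ)
    (hup : ∀ x ∈ Icc a b, u x = u x₀ + ∫ s in x₀..x, p s * w 1 s)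
    (hpu : ∀ x ∈ Icc a b, p x = p x₀ + lam * ∫ s in x₀..x, u s * w 0 s) {x : ℝ}
    (hx : x ∈ Icc a b) :
    Tendsto (fun N => ∑ k ∈ Finset.range N, lam ^ k * (u x₀ * iterInt x₀ w 1 (2 * k) x +
      p x₀ * iterInt x₀ (fun n => w (n + 1)) 1 (2 * k + 1) x)) atTop (nhds (u x)) := by
  obtain ⟨M, hM⟩ := isCompact_Icc.exists_bound_of_continuousOn hu
  have hone : ContinuousOn (1 : ℝ → ℂ) (Icc a b) := continuousOn_const
  have hH : ContinuousOn (iterInt x₀ (fun n => w (n + 1)) 1 1) (Icc a b) :=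
    continuousOn_iterInt hx₀ (fun n => hw (n + 1)) hone 1
  have hR : ContinuousOn (iterInt x₀ w u 2) (Icc a b) := continuousOn_iterInt hx₀ hw hu 2
  have hbase : ∀ x ∈ Icc a b, u x = u x₀ * (1 : ℝ → ℂ) x +
      p x₀ * iterInt x₀ (fun n => w (n + 1)) 1 1 x + lam * iterInt x₀ w u 2 x := by
    intro x hx
    have hI : IntervalIntegrable (w 1) volume x₀ x :=
      intervalIntegrable_of_continuousOn_Icc (hw 1) hx₀ hx
    have hJ : IntervalIntegrable (fun s => iterInt x₀ w u 1 s * w 1 s) volume x₀ x :=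
      intervalIntegrable_of_continuousOn_Icc
        ((continuousOn_iterInt hx₀ hw hu 1).mul (hw 1)) hx₀ hx
    have hvw : ∫ s in x₀..x, p s * w 1 s =
        ∫ s in x₀..x, (p x₀ * w 1 s + lam * (iterInt x₀ w u 1 s * w 1 s)) := by
      refine intervalIntegral.integral_congr fun s hs => ?_
      simp only [hpu s (uIcc_subset_Icc hx₀ hx hs), iterInt]
      ring
    rw [hup x hx, hvw, intervalIntegral.integral_add (hI.const_mul _) (hJ.const_mul _),
      intervalIntegral.integral_const_mul, intervalIntegral.integral_const_mul]
    simp [iterInt, add_assoc]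
  have hstep : ∀ n, iterInt x₀ w u n x = u x₀ * iterInt x₀ w 1 n x +
      p x₀ * iterInt x₀ (fun n => w (n + 1)) 1 (n + 1) x + lam * iterInt x₀ w u (n + 2) x := by
    intro n
    have h := iterInt_add_add_mul hx₀ hw hone hH hR _ _ _ hbase n x hx
    rw [add_comm n 2, add_comm n 1, iterInt_add x₀ w u 2 n, iterInt_add x₀ _ 1 1 n]
    have h1 : (fun k => w (2 + k)) = w := funext hper
    have h2 : (fun k => w (1 + k + 1)) = w := by
      funext k
      rw [← hper k]
      congr 1
      ring
    simpa only [h1, h2] using h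
  have hsum : ∀ N, ∑ k ∈ Finset.range N, lam ^ k * (u x₀ * iterInt x₀ w 1 (2 * k) x +
      p x₀ * iterInt x₀ (fun n => w (n + 1)) 1 (2 * k + 1) x) =
      u x - lam ^ N * iterInt x₀ w u (2 * N) x := by
    intro N
    induction N with
    | zero => simp [iterInt]
    | succ N ih =>
      rw [Finset.sum_range_succ, ih, hstep (2 * N), mul_add_one]
      ring
  simp only [hsum]
  have hlim : Tendsto (fun N => lam ^ N * iterInt x₀ w u (2 * N) x) atTop (nhds 0) := by
    have hC0 : 0 ≤ C := (norm_nonneg _).trans (hC 0 _ hx₀)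
    refine squeeze_zero_norm (a := fun N =>
      M * (((‖lam‖ + 1) * (C * |x - x₀|)) ^ (2 * N) / (2 * N).factorial)) (fun N => ?_) ?_
    · have hl : ‖lam‖ ^ N ≤ (‖lam‖ + 1) ^ (2 * N) :=
        (pow_le_pow_left₀ (norm_nonneg _) (by linarith) N).trans
          (pow_le_pow_right₀ (by linarith [norm_nonneg lam]) (by omega))
      rw [norm_mul, norm_pow]
      calc _ ≤ (‖lam‖ + 1) ^ (2 * N) * (M * ((C * |x - x₀|) ^ (2 * N) / (2 * N).factorial)) :=
            mul_le_mul hl (norm_iterInt_le hx₀ hC hM _ x hx) (norm_nonneg _) (by positivity)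
        _ = _ := by rw [mul_pow (‖lam‖ + 1)]; ring
    · have h := (FloorSemiring.tendsto_pow_div_factorial_atTop
        ((‖lam‖ + 1) * (C * |x - x₀|))).comp
        (tendsto_id.const_mul_atTop' (by norm_num : (0 : ℕ) < 2))
      simpa using h.const_mul M
  simpa using hlim.const_sub (u x)

theorem norm_pow_mul_iterInt_one_le {w : ℕ → ℝ → ℂ} {C : ℝ} (hx₀ : x₀ ∈ Icc a b)
    (hC : ∀ n, ∀ x ∈ Icc a b, ‖w n x‖ ≤ C) (lam : ℂ) {k n : ℕ} (hkn : k ≤ n) {x : ℝ}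
    (hx : x ∈ Icc a b) :
    ‖lam ^ k * iterInt x₀ w 1 n x‖ ≤ ((‖lam‖ + 1) * C * |x - x₀|) ^ n / n.factorial := by
  have hl : ‖lam‖ ^ k ≤ (‖lam‖ + 1) ^ n :=
    (pow_le_pow_left₀ (norm_nonneg _) (by linarith) k).trans
      (pow_le_pow_right₀ (by linarith [norm_nonneg lam]) hkn)
  have hb := norm_iterInt_le (v := 1) (M := 1) hx₀ hC (by simp) n x hx
  rw [one_mul] at hb
  rw [norm_mul, norm_pow]
  calc _ ≤ (‖lam‖ + 1) ^ n * ((C * |x - x₀|) ^ n / n.factorial) :=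
        mul_le_mul hl hb (norm_nonneg _) (by positivity)
    _ = _ := by rw [mul_assoc, mul_pow (‖lam‖ + 1)]; ring

theorem summable_pow_mul_iterInt_even {w : ℕ → ℝ → ℂ} {C : ℝ} (hx₀ : x₀ ∈ Icc a b)
    (hC : ∀ n, ∀ x ∈ Icc a b, ‖w n x‖ ≤ C) (lam : ℂ) {x : ℝ} (hx : x ∈ Icc a b) :
    Summable fun k : ℕ => lam ^ k * iterInt x₀ w 1 (2 * k) x :=
  Summable.of_norm_bounded
    ((Real.summable_pow_div_factorial _).comp_injective (i := fun k : ℕ => 2 * k)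
      fun i j h => by simpa using h)
    fun k => norm_pow_mul_iterInt_one_le hx₀ hC lam (by omega) hx

theorem summable_pow_mul_iterInt_odd {w : ℕ → ℝ → ℂ} {C : ℝ} (hx₀ : x₀ ∈ Icc a b)
    (hC : ∀ n, ∀ x ∈ Icc a b, ‖w n x‖ ≤ C) (lam : ℂ) {x : ℝ} (hx : x ∈ Icc a b) :
    Summable fun k : ℕ => lam ^ k * iterInt x₀ w 1 (2 * k + 1) x :=
  Summable.of_norm_bounded
    ((Real.summable_pow_div_factorial _).comp_injective (i := fun k : ℕ => 2 * k + 1)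
      fun i j h => by simpa using h)
    fun k => norm_pow_mul_iterInt_one_le hx₀ hC lam (by omega) hx

theorem exists_tsum_iterInt_odd_ne_zero {w : ℕ → ℝ → ℂ} {C : ℝ} (hab : a < b)
    (hx₀ : x₀ ∈ Icc a b) (hw : ContinuousOn (w 0) (Icc a b))
    (hC : ∀ n, ∀ x ∈ Icc a b, ‖w n x‖ ≤ C) (hne : w 0 x₀ ≠ 0) (lam : ℂ) :
    ∃ x ∈ Icc a b, ∑' k : ℕ, lam ^ k * iterInt x₀ w 1 (2 * k + 1) x ≠ 0 := by
  by_contra! hzero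
  have hC0 : 0 ≤ C := (norm_nonneg _).trans (hC 0 _ hx₀)
  set D := (‖lam‖ + 1) * C
  have hD0 : 0 ≤ D := by positivity
  have hsumm : Summable fun k : ℕ => (D * (b - a)) ^ (2 * k + 1) / (2 * k + 1).factorial :=
    (Real.summable_pow_div_factorial (D * (b - a))).comp_injective (i := fun k : ℕ => 2 * k + 1)
      fun i j h => by simpa using h
  set S := ∑' k : ℕ, (D * (b - a)) ^ (2 * k + 1) / (2 * k + 1).factorial
  have hbound : ∀ x ∈ Icc a b, ‖∫ s in x₀..x, w 0 s‖ ≤ D ^ 2 * S * |x - x₀| ^ 2 := by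
    intro x hx
    have hs := (summable_pow_mul_iterInt_odd hx₀ hC lam hx).tsum_eq_zero_add
    rw [hzero x hx] at hs
    have hHeq : ∫ s in x₀..x, w 0 s =
        -∑' k : ℕ, lam ^ (k + 1) * iterInt x₀ w 1 (2 * (k + 1) + 1) x := by
      rw [eq_neg_iff_add_eq_zero, hs]
      simp [iterInt]
    rw [hHeq, norm_neg]
    have hxabs : |x - x₀| ≤ b - a := abs_sub_le_iff.2
      ⟨by linarith [hx.2, hx₀.1], by linarith [hx.1, hx₀.2]⟩
    refine (tsum_of_norm_bounded (hsumm.hasSum.mul_left (D ^ 2 * |x - x₀| ^ 2))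
      fun k => ?_).trans_eq (by ring)
    refine (norm_pow_mul_iterInt_one_le hx₀ hC lam (by omega) hx).trans ?_
    calc (D * |x - x₀|) ^ (2 * (k + 1) + 1) / (2 * (k + 1) + 1).factorial
        = D ^ 2 * |x - x₀| ^ 2 *
          ((D * |x - x₀|) ^ (2 * k + 1) / (2 * (k + 1) + 1).factorial) := by ring
      _ ≤ _ := by
        gcongr
        omega
  have hder : HasDerivWithinAt (fun x => ∫ s in x₀..x, w 0 s) (w 0 x₀) (Icc a b) x₀ := by
    have : Fact (x₀ ∈ Icc a b) := ⟨hx₀⟩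
    exact intervalIntegral.integral_hasDerivWithinAt_right (by simp)
      (hw.stronglyMeasurableAtFilter_nhdsWithin measurableSet_Icc x₀) (hw x₀ hx₀)
  have hder0 : HasDerivWithinAt (fun x => ∫ s in x₀..x, w 0 s) 0 (Icc a b) x₀ := by
    rw [hasDerivWithinAt_iff_isLittleO]
    have hO : (fun x => ∫ s in x₀..x, w 0 s) =O[nhdsWithin x₀ (Icc a b)]
        fun x => (x - x₀) ^ 2 := by
      refine Asymptotics.IsBigO.of_bound (D ^ 2 * S) ?_
      filter_upwards [self_mem_nhdsWithin] with x hx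
      simpa using hbound x hx
    have ho : (fun x : ℝ => (x - x₀) ^ 2) =o[nhdsWithin x₀ (Icc a b)] fun x => x - x₀ := by
      have := (Asymptotics.isLittleO_pow_sub_sub x₀ (m := 2) (by norm_num)).mono
        (nhdsWithin_le_nhds (s := Icc a b))
      simpa using this
    simpa using hO.trans_isLittleO ho
  exact hne (((uniqueDiffOn_Icc hab) x₀ hx₀).eq_deriv _ hder hder0)

theorem hasDerivAt_derivWithin_Icc {y : ℝ → ℂ} (hy : ContDiffOn ℝ 2 y (Ioo a b)) {x : ℝ}
    (hx : x ∈ Ioo a b) : HasDerivAt (derivWithin y (Icc a b))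
      (derivWithin (derivWithin y (Icc a b)) (Icc a b) x) x := by
  have heq : derivWithin y (Icc a b) =ᶠ[nhds x] deriv y := by
    filter_upwards [isOpen_Ioo.mem_nhds hx] with z hz
    exact derivWithin_of_mem_nhds (Icc_mem_nhds hz.1 hz.2)
  have hd : DifferentiableAt ℝ (deriv y) x :=
    (((contDiffOn_succ_iff_deriv_of_isOpen (n := 1) isOpen_Ioo).1
      (by simpa [one_add_one_eq_two] using hy)).2.2.differentiableOn one_ne_zero x hx).differentiableAt
      (isOpen_Ioo.mem_nhds hx)
  rw [derivWithin_of_mem_nhds (Icc_mem_nhds hx.1 hx.2)]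
  exact (hd.congr_of_eventuallyEq heq).hasDerivAt

theorem eq_add_integral_of_hasDerivAt {g g' : ℝ → ℂ} (hx₀ : x₀ ∈ Icc a b)
    (hg : ContinuousOn g (Icc a b)) (hg' : ContinuousOn g' (Icc a b))
    (hd : ∀ x ∈ Ioo a b, HasDerivAt g (g' x) x) {x : ℝ} (hx : x ∈ Icc a b) :
    g x = g x₀ + ∫ s in x₀..x, g' s := by
  rw [intervalIntegral.integral_eq_sub_of_hasDeriv_right
    (hg.mono (uIcc_subset_Icc hx₀ hx)) (fun s hs => ?_)
    (intervalIntegrable_of_continuousOn_Icc hg' hx₀ hx)]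
  · ring
  · exact (hd s ⟨(le_min hx₀.1 hx.1).trans_lt hs.1,
      hs.2.trans_le (max_le hx₀.2 hx.2)⟩).hasDerivWithinAt

end Interval

theorem Xtrec_eq_iterInt (x₀ : ℝ) (f : ℝ → ℂ) (n : ℕ) (x : ℝ) :
    Xtrec x₀ f n x =
      n.factorial * iterInt x₀ (fun n s => (f s ^ 2) ^ ((-1 : ℤ) ^ n)) 1 n x := by
  induction n generalizing x with
  | zero => simp [Xtrec, iterInt]
  | succ n ih =>
    simp only [Xtrec, iterInt, ih, mul_assoc, intervalIntegral.integral_const_mul,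
      Nat.factorial_succ]
    push_cast
    ring

theorem Xrec_eq_iterInt (x₀ : ℝ) (f : ℝ → ℂ) (n : ℕ) (x : ℝ) :
    Xrec x₀ f n x =
      n.factorial * iterInt x₀ (fun n s => (f s ^ 2) ^ ((-1 : ℤ) ^ (n + 1))) 1 n x := by
  induction n generalizing x with
  | zero => simp [Xrec, iterInt]
  | succ n ih =>
    simp only [Xrec, iterInt, ih, mul_assoc, intervalIntegral.integral_const_mul,
      Nat.factorial_succ]
    push_cast
    ring

theorem sppsY1_eq (x₀ : ℝ) (f : ℝ → ℂ) (lam : ℂ) (x : ℝ) :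
    sppsY1 x₀ f lam x = f x * ∑' k : ℕ, lam ^ k *
      iterInt x₀ (fun n s => (f s ^ 2) ^ ((-1 : ℤ) ^ n)) 1 (2 * k) x := by
  rw [sppsY1, ← tsum_mul_left]
  refine tsum_congr fun k => ?_
  have h : ((2 * k).factorial : ℂ) ≠ 0 := by exact_mod_cast Nat.factorial_ne_zero _
  rw [phiF, if_neg (by simp), Xtrec_eq_iterInt]
  field_simp

theorem sppsY2_eq (x₀ : ℝ) (f : ℝ → ℂ) (lam : ℂ) (x : ℝ) :
    sppsY2 x₀ f lam x = f x * ∑' k : ℕ, lam ^ k *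
      iterInt x₀ (fun n s => (f s ^ 2) ^ ((-1 : ℤ) ^ (n + 1))) 1 (2 * k + 1) x := by
  rw [sppsY2, ← tsum_mul_left]
  refine tsum_congr fun k => ?_
  have h : ((2 * k + 1).factorial : ℂ) ≠ 0 := by exact_mod_cast Nat.factorial_ne_zero _
  rw [phiF, if_pos (by simp), Xrec_eq_iterInt]
  field_simp

/-- every `C²(a,b) ∩ C¹[a,b]` solution of `y'' − q y = λ y` on `(a,b)` is a
unique linear combination `c₁ y₁ + c₂ y₂` of the SPPS solutions on `[a,b]`. -/
theorem spps_general_solution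
    (a b : ℝ) (hab : a < b) (q : ℝ → ℂ) (hq : ContinuousOn q (Set.Icc a b))
    (f : ℝ → ℂ) (hf1 : ContDiffOn ℝ 1 f (Set.Icc a b)) (hf2 : ContDiffOn ℝ 2 f (Set.Ioo a b))
    (hfeq : ∀ x ∈ Set.Ioo a b,
      derivWithin (derivWithin f (Set.Icc a b)) (Set.Icc a b) x = q x * f x)
    (hfne : ∀ x ∈ Set.Icc a b, f x ≠ 0)
    (x₀ : ℝ) (hx₀ : x₀ ∈ Set.Icc a b) (lam : ℂ)
    (y : ℝ → ℂ) (hy1 : ContDiffOn ℝ 1 y (Set.Icc a b)) (hy2 : ContDiffOn ℝ 2 y (Set.Ioo a b))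
    (hyeq : ∀ x ∈ Set.Ioo a b,
      derivWithin (derivWithin y (Set.Icc a b)) (Set.Icc a b) x - q x * y x = lam * y x) :
    ∃! c : ℂ × ℂ, ∀ x ∈ Set.Icc a b,
      y x = c.1 * sppsY1 x₀ f lam x + c.2 * sppsY2 x₀ f lam x := by
  set w : ℕ → ℝ → ℂ := fun n s => (f s ^ 2) ^ ((-1 : ℤ) ^ n) with hwdef
  have hper : ∀ n, w (2 + n) = w n := fun n => by simp [hwdef, pow_add]
  have hw0 : ∀ s, w 0 s = f s ^ 2 := fun s => by simp [hwdef]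
  have hw1 : ∀ s, w 1 s = (f s ^ 2)⁻¹ := fun s => by simp [hwdef]
  have hfc := hf1.continuousOn
  have hw : ∀ n, ContinuousOn (w n) (Icc a b) := fun n =>
    (hfc.pow 2).zpow₀ _ fun x hx => Or.inl (pow_ne_zero 2 (hfne x hx))
  obtain ⟨C₀, hC₀⟩ := isCompact_Icc.exists_bound_of_continuousOn (hw 0)
  obtain ⟨C₁, hC₁⟩ := isCompact_Icc.exists_bound_of_continuousOn (hw 1)
  have hC : ∀ n, ∀ x ∈ Icc a b, ‖w n x‖ ≤ max C₀ C₁ := by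
    intro n
    induction n using Nat.twoStepInduction with
    | zero => exact fun x hx => (hC₀ x hx).trans (le_max_left _ _)
    | one => exact fun x hx => (hC₁ x hx).trans (le_max_right _ _)
    | more n ih _ => rwa [add_comm n 2, hper n]
  have hC' : ∀ n, ∀ x ∈ Icc a b, ‖w (n + 1) x‖ ≤ max C₀ C₁ := fun n => hC (n + 1)
  have hfx₀ := hfne x₀ hx₀
  have hud := uniqueDiffOn_Icc hab
  set f' := derivWithin f (Icc a b)
  set y' := derivWithin y (Icc a b)
  have hyc := hy1.continuousOn
  have hf'c : ContinuousOn f' (Icc a b) := hf1.continuousOn_derivWithin hud le_rfl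
  have hy'c : ContinuousOn y' (Icc a b) := hy1.continuousOn_derivWithin hud le_rfl
  have hder : ∀ {g : ℝ → ℂ}, ContDiffOn ℝ 1 g (Icc a b) → ∀ x ∈ Ioo a b,
      HasDerivAt g (derivWithin g (Icc a b) x) x := fun hg x hx =>
    ((hg.differentiableOn one_ne_zero) x (Ioo_subset_Icc_self hx)).hasDerivWithinAt.hasDerivAt
      (Icc_mem_nhds hx.1 hx.2)
  set u : ℝ → ℂ := fun x => y x / f x with hudef
  set p : ℝ → ℂ := fun x => y' x * f x - y x * f' x
  have huc : ContinuousOn u (Icc a b) := hyc.div hfc hfne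
  have hpc : ContinuousOn p (Icc a b) := (hy'c.mul hfc).sub (hyc.mul hf'c)
  have hup : ∀ x ∈ Icc a b, u x = u x₀ + ∫ s in x₀..x, p s * w 1 s := fun x hx =>
    eq_add_integral_of_hasDerivAt hx₀ huc (hpc.mul (hw 1)) (fun x hx => by
      have h := (hder hy1 x hx).div (hder hf1 x hx) (hfne x (Ioo_subset_Icc_self hx))
      refine h.congr_deriv ?_
      rw [Pi.mul_apply, hw1, div_eq_mul_inv]) hx
  have hpu : ∀ x ∈ Icc a b, p x = p x₀ + lam * ∫ s in x₀..x, u s * w 0 s := fun x hx => by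
    rw [← intervalIntegral.integral_const_mul]
    refine eq_add_integral_of_hasDerivAt hx₀ hpc
      (continuousOn_const.mul (huc.mul (hw 0))) (fun x hx => ?_) hx
    have hfx := hfne x (Ioo_subset_Icc_self hx)
    have h := ((hasDerivAt_derivWithin_Icc hy2 hx).mul (hder hf1 x hx)).sub
      ((hder hy1 x hx).mul (hasDerivAt_derivWithin_Icc hf2 hx))
    refine h.congr_deriv ?_
    simp only [Pi.mul_apply, hw0, hudef]
    rw [hfeq x hx, sub_eq_iff_eq_add.1 (hyeq x hx)]
    field_simp
    ring
  have hrep : ∀ x ∈ Icc a b,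
      y x = u x₀ * sppsY1 x₀ f lam x + p x₀ * sppsY2 x₀ f lam x := by
    intro x hx
    have ht := tendsto_sum_iterInt_of_integral_eq hx₀ hw hC hper huc lam hup hpu hx
    have hs := (((summable_pow_mul_iterInt_even hx₀ hC lam hx).hasSum.mul_left (u x₀)).add
      ((summable_pow_mul_iterInt_odd hx₀ hC' lam hx).hasSum.mul_left (p x₀))).tendsto_sum_nat
    have hux := tendsto_nhds_unique ht (hs.congr fun N => Finset.sum_congr rfl fun k _ => by ring)
    have hyx : y x = f x * u x := by
      have := hfne x hx
      simp only [hudef]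
      field_simp
    rw [hyx, hux, sppsY1_eq, sppsY2_eq]
    ring
  obtain ⟨x₁, hx₁, hne⟩ := exists_tsum_iterInt_odd_ne_zero (w := fun n => w (n + 1)) hab hx₀
    (hw 1) hC' (by simpa [hw1] using hfx₀) lam
  have hY2 : sppsY2 x₀ f lam x₁ ≠ 0 := by
    rw [sppsY2_eq]
    exact mul_ne_zero (hfne x₁ hx₁) hne
  have hY1x₀ : sppsY1 x₀ f lam x₀ = f x₀ := by
    rw [sppsY1_eq, tsum_eq_single 0]
    · simp [iterInt]
    · rintro (_ | k) hk
      · exact absurd rfl hk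
      · simp [mul_add_one, iterInt]
  have hY2x₀ : sppsY2 x₀ f lam x₀ = 0 := by
    rw [sppsY2_eq]
    simp [iterInt]
  refine ⟨(u x₀, p x₀), hrep, ?_⟩
  rintro ⟨c₁, c₂⟩ hc
  have h₁ : c₁ = u x₀ := by
    have h := (hc x₀ hx₀).symm.trans (hrep x₀ hx₀)
    simp only [hY1x₀, hY2x₀, mul_zero, add_zero] at h
    exact mul_right_cancel₀ hfx₀ h
  have h₂ : c₂ = p x₀ := by
    have h := (hc x₁ hx₁).symm.trans (hrep x₁ hx₁)
    simp only [h₁] at h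
    exact mul_right_cancel₀ hY2 (add_left_cancel h)
  rw [h₁, h₂]
end
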